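/- Let x be an element of a Garside group G of finite type. If the canonical length ℓ(x) is not minimal among the canonical lengths of the conjugates of x, then ℓ(x) > ℓ(𝔰^m(x)) for some positive integer m < ||Δ||. In particular, SC(x) ⊆ SSS(x). -/

import Mathlib

/-- A Garside structure of finite type on a group `G`: a submonoid `P` of positive
elements with `P ∩ P⁻¹ = {1}`, such that the prefix order `a ⪯ b ↔ a⁻¹ * b ∈ P` is a
lattice order (with meet `wedge` and join `vee`), together with a Garside element `Δ ∈ P`
whose set of prefixes (the simple elements) is finite and generates `G`, satisfying
`Δ⁻¹ P Δ = P`, and such that every nontrivial positive element has a finite norm. -/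
structure GarsideStructure (G : Type*) [Group G] where
  P : Set G
  one_mem : (1 : G) ∈ P
  mul_mem : ∀ {a b : G}, a ∈ P → b ∈ P → a * b ∈ P
  eq_one_of_mem_of_inv_mem : ∀ a : G, a ∈ P → a⁻¹ ∈ P → a = 1
  wedge : G → G → G
  vee : G → G → G
  wedge_le_left : ∀ a b : G, (wedge a b)⁻¹ * a ∈ P
  wedge_le_right : ∀ a b : G, (wedge a b)⁻¹ * b ∈ P
  le_wedge : ∀ a b c : G, c⁻¹ * a ∈ P → c⁻¹ * b ∈ P → c⁻¹ * wedge a b ∈ P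
  le_vee_left : ∀ a b : G, a⁻¹ * vee a b ∈ P
  le_vee_right : ∀ a b : G, b⁻¹ * vee a b ∈ P
  vee_le : ∀ a b c : G, a⁻¹ * c ∈ P → b⁻¹ * c ∈ P → (vee a b)⁻¹ * c ∈ P
  Δ : G
  Δ_mem : Δ ∈ P
  simples_finite : {s : G | s ∈ P ∧ s⁻¹ * Δ ∈ P}.Finite
  simples_generate : Subgroup.closure {s : G | s ∈ P ∧ s⁻¹ * Δ ∈ P} = (⊤ : Subgroup G)
  conj_Delta_mem : ∀ a : G, a ∈ P → Δ⁻¹ * a * Δ ∈ P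
  mem_of_conj_Delta_mem : ∀ a : G, Δ⁻¹ * a * Δ ∈ P → a ∈ P
  norm_bounded : ∀ x : G, x ∈ P → x ≠ 1 →
    ∃ n : ℕ, ∀ L : List G, (∀ a ∈ L, a ∈ P ∧ a ≠ 1) → L.prod = x → L.length ≤ n

namespace GarsideStructure

variable {G : Type*} [Group G] (gs : GarsideStructure G)

/-- The prefix order: `a ⪯ b`. -/
def pre (a b : G) : Prop := a⁻¹ * b ∈ gs.P

/-- The suffix order: `a ≽ b` (i.e. `b` is a suffix of `a`). -/
def rdvd (a b : G) : Prop := a * b⁻¹ ∈ gs.P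

/-- Greatest common divisor with respect to the suffix order `≽` : `a ∧↰ b`. -/
def rwedge (a b : G) : G := (gs.vee a⁻¹ b⁻¹)⁻¹

/-- Least common multiple with respect to the suffix order `≽` : `a ∨↰ b`. -/
def rvee (a b : G) : G := (gs.wedge a⁻¹ b⁻¹)⁻¹

/-- Simple elements: positive prefixes of `Δ`. -/
def simple (s : G) : Prop := s ∈ gs.P ∧ s⁻¹ * gs.Δ ∈ gs.P

/-- Atoms: nontrivial positive elements which cannot be decomposed in `P`. -/
def atom (a : G) : Prop := a ∈ gs.P ∧ a ≠ 1 ∧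
  ∀ b c : G, b ∈ gs.P → c ∈ gs.P → a = b * c → b = 1 ∨ c = 1

/-- `inf x` : the maximal integer `p` with `Δ^p ⪯ x`. -/
noncomputable def ginf (x : G) : ℤ := sSup {p : ℤ | gs.pre (gs.Δ ^ p) x}

/-- `sup x` : the minimal integer `p` with `x ⪯ Δ^p`. -/
noncomputable def gsup (x : G) : ℤ := sInf {p : ℤ | gs.pre x (gs.Δ ^ p)}

/-- Canonical length `ℓ(x) = sup(x) - inf(x)`. -/
noncomputable def glen (x : G) : ℤ := gs.gsup x - gs.ginf x

/-- `‖x‖` : the maximal number of factors in a decomposition of `x` as a product of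
nontrivial positive elements. -/
noncomputable def gnorm (x : G) : ℕ :=
  sSup {k : ℕ | ∃ L : List G, (∀ a ∈ L, a ∈ gs.P ∧ a ≠ 1) ∧ L.prod = x ∧ L.length = k}

/-- The summit infimum `inf_s(x)` : the maximum of `inf` over the conjugacy class of `x`. -/
noncomputable def ginfs (x : G) : ℤ :=
  sSup {p : ℤ | ∃ y : G, (∃ α : G, α⁻¹ * x * α = y) ∧ p = gs.ginf y}

/-- The summit supremum `sup_s(x)` : the minimum of `sup` over the conjugacy class of `x`. -/
noncomputable def gsups (x : G) : ℤ :=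
  sInf {p : ℤ | ∃ y : G, (∃ α : G, α⁻¹ * x * α = y) ∧ p = gs.gsup y}

/-- The preferred prefix `𝔭(x) = (xΔ^{-inf x}) ∧ (x⁻¹Δ^{sup x}) ∧ Δ`. -/
noncomputable def pp (x : G) : G :=
  gs.wedge (gs.wedge (x * gs.Δ ^ (-gs.ginf x)) (x⁻¹ * gs.Δ ^ gs.gsup x)) gs.Δ

/-- Cyclic (left) sliding `𝔰(x) = 𝔭(x)⁻¹ x 𝔭(x)`. -/
noncomputable def sl (x : G) : G := (gs.pp x)⁻¹ * x * gs.pp x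

/-- The preferred suffix `𝔭↰(x) = (Δ^{-inf x}x) ∧↰ (Δ^{sup x}x⁻¹) ∧↰ Δ`. -/
noncomputable def ps (x : G) : G :=
  gs.rwedge (gs.rwedge (gs.Δ ^ (-gs.ginf x) * x) (gs.Δ ^ gs.gsup x * x⁻¹)) gs.Δ

/-- Cyclic right sliding `𝔰↰(x) = 𝔭↰(x) x 𝔭↰(x)⁻¹`. -/
noncomputable def rsl (x : G) : G := gs.ps x * x * (gs.ps x)⁻¹

/-- The super summit set `SSS(x)` : conjugates of `x` with maximal infimum and minimal
supremum among all conjugates of `x`. -/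
def SSS (x : G) : Set G :=
  {y | (∃ α : G, α⁻¹ * x * α = y) ∧
    ∀ z : G, (∃ α : G, α⁻¹ * x * α = z) → gs.ginf z ≤ gs.ginf y ∧ gs.gsup y ≤ gs.gsup z}

/-- The set of sliding circuits `SC(x)` : conjugates `y` of `x` with `𝔰^m(y) = y` for
some `m ≥ 1`. -/
noncomputable def SC (x : G) : Set G :=
  {y | (∃ α : G, α⁻¹ * x * α = y) ∧ ∃ m : ℕ, 1 ≤ m ∧ (gs.sl)^[m] y = y}

/-- The transport `α^{(1)} = 𝔭(x)⁻¹ α 𝔭(x^α)` of `α` at `x`. -/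
noncomputable def transport (x α : G) : G := (gs.pp x)⁻¹ * α * gs.pp (α⁻¹ * x * α)

/-- Iterated transport `α^{(i)}` of `α` at `x`: `α^{(0)} = α` and `α^{(i+1)}` is the
transport of `α^{(i)}` at `𝔰^i(x)`. -/
noncomputable def transportIter (x α : G) : ℕ → G
  | 0 => α
  | i + 1 => gs.transport ((gs.sl)^[i] x) (transportIter x α i)

/-- `c` is the `⪯`-minimal element `c_s(y)` satisfying `s ⪯ c` and `y^c ∈ SC(x)`. -/
def IsMinSCConj (x y s c : G) : Prop :=
  gs.pre s c ∧ (c⁻¹ * y * c) ∈ gs.SC x ∧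
    ∀ d : G, gs.pre s d → (d⁻¹ * y * d) ∈ gs.SC x → gs.pre c d

/-- `s` is an indecomposable conjugator starting at `u`: `u^s ∈ SC(x)`, `s ≠ 1` and there
is no `t` with `1 ≺ t ≺ s` and `u^t ∈ SC(x)`. -/
def IsIndecomposableConjugator (x u s : G) : Prop :=
  (s⁻¹ * u * s) ∈ gs.SC x ∧ s ≠ 1 ∧
    ¬ ∃ t : G, (gs.pre 1 t ∧ t ≠ 1) ∧ (gs.pre t s ∧ t ≠ s) ∧ (t⁻¹ * u * t) ∈ gs.SC x

/-- `u` is the pullback of `s` at `y = 𝔰(z)` : the `⪯`-minimal positive element with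
`z^u ∈ SSS(x)` and `s ⪯ u^{(1)}` (transport at `z`). -/
def IsPullback (x z s u : G) : Prop :=
  u ∈ gs.P ∧ (u⁻¹ * z * u) ∈ gs.SSS x ∧ gs.pre s (gs.transport z u) ∧
    ∀ u' : G, u' ∈ gs.P → (u'⁻¹ * z * u') ∈ gs.SSS x → gs.pre s (gs.transport z u') →
      gs.pre u u'

/-- The pullback `s_{(1)}` of `s` at `y = 𝔰(z)`. -/
noncomputable def pullbackOne (x z s : G) : G :=
  @Classical.epsilon G ⟨1⟩ (fun u => gs.IsPullback x z s u)

/-- The `k`-fold pullback `s_{(k)}` of `s` at `y = 𝔰^k(z)` (an element at `z`):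
`s_{(0)} = s` and `s_{(k+1)}` is the pullback at `𝔰(z)` (relative to `z`) of the `k`-fold
pullback of `s` at `𝔰^k(𝔰(z)) = y`. -/
noncomputable def pullbackIter (x : G) : G → ℕ → G → G
  | _, 0, s => s
  | z, k + 1, s => gs.pullbackOne x z (pullbackIter x (gs.sl z) k s)

end GarsideStructure

open GarsideStructure

variable {G : Type*} [Group G]

namespace GarsideStructure

section Order

variable (gs : GarsideStructure G)

lemma pre_refl (a : G) : gs.pre a a := by
  simpa [pre] using gs.one_mem

variable {gs}

lemma pre.trans {a b c : G} (h : gs.pre a b) (h' : gs.pre b c) : gs.pre a c := by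
  have := gs.mul_mem h h'
  simpa [pre, mul_assoc] using this

lemma pre.antisymm {a b : G} (h : gs.pre a b) (h' : gs.pre b a) : a = b := by
  have := gs.eq_one_of_mem_of_inv_mem (a⁻¹ * b) h (by simpa [pre] using h')
  exact (eq_of_inv_mul_eq_one this)

variable (gs)

lemma pre_mul_left (g : G) {a b : G} : gs.pre (g * a) (g * b) ↔ gs.pre a b := by
  simp [pre, mul_assoc]

lemma one_pre {a : G} : gs.pre 1 a ↔ a ∈ gs.P := by
  simp [pre]

lemma conj_Delta_mem_iff {a : G} : gs.Δ⁻¹ * a * gs.Δ ∈ gs.P ↔ a ∈ gs.P :=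
  ⟨gs.mem_of_conj_Delta_mem a, gs.conj_Delta_mem a⟩

lemma conj_Delta_zpow_mem_iff (n : ℤ) (a : G) :
    (gs.Δ ^ n)⁻¹ * a * gs.Δ ^ n ∈ gs.P ↔ a ∈ gs.P := by
  induction n generalizing a with
  | zero => simp
  | succ n ih =>
    rw [← ih a, ← gs.conj_Delta_mem_iff (a := (gs.Δ ^ (n : ℤ))⁻¹ * a * gs.Δ ^ (n : ℤ)), zpow_add_one]
    simp only [mul_inv_rev, mul_assoc]
  | pred n ih =>
    rw [← ih a, ← gs.conj_Delta_mem_iff, zpow_sub_one]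
    simp only [mul_inv_rev, mul_assoc, inv_inv, inv_mul_cancel_left, inv_mul_cancel, mul_one]

lemma pre_mul_Delta_zpow (n : ℤ) {a b : G} :
    gs.pre (a * gs.Δ ^ n) (b * gs.Δ ^ n) ↔ gs.pre a b := by
  rw [pre, pre, ← gs.conj_Delta_zpow_mem_iff n (a⁻¹ * b)]
  simp only [mul_inv_rev, mul_assoc]

lemma pre_mul_Delta {a b : G} : gs.pre (a * gs.Δ) (b * gs.Δ) ↔ gs.pre a b := by
  simpa using gs.pre_mul_Delta_zpow 1 (a := a) (b := b)

lemma pre_self_mul_Delta (a : G) : gs.pre a (a * gs.Δ) := by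
  simpa [pre] using gs.Δ_mem

lemma Delta_pow_mem (n : ℕ) : gs.Δ ^ n ∈ gs.P := by
  induction n with
  | zero => simpa using gs.one_mem
  | succ n ih => rw [pow_succ]; exact gs.mul_mem ih gs.Δ_mem

lemma pre_mul_zpow_of_le (a : G) {m n : ℤ} (h : m ≤ n) :
    gs.pre (a * gs.Δ ^ m) (a * gs.Δ ^ n) := by
  obtain ⟨k, rfl⟩ := Int.le.dest h
  have := gs.Delta_pow_mem k
  simpa [pre, mul_assoc, zpow_add] using this

lemma pre_wedge_iff {a b c : G} : gs.pre c (gs.wedge a b) ↔ gs.pre c a ∧ gs.pre c b :=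
  ⟨fun h => ⟨h.trans (gs.wedge_le_left a b), h.trans (gs.wedge_le_right a b)⟩,
    fun h => gs.le_wedge a b c h.1 h.2⟩

lemma eq_of_forall_pre_iff {a b : G} (h : ∀ t, gs.pre t a ↔ gs.pre t b) : a = b :=
  ((h a).1 (gs.pre_refl a)).antisymm ((h b).2 (gs.pre_refl b))

lemma mul_wedge (g a b : G) : g * gs.wedge a b = gs.wedge (g * a) (g * b) := by
  refine gs.eq_of_forall_pre_iff fun t => ?_
  obtain ⟨t, rfl⟩ : ∃ s, t = g * s := ⟨g⁻¹ * t, by simp⟩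
  simp only [pre_mul_left, pre_wedge_iff]

lemma wedge_mul_Delta_zpow (n : ℤ) (a b : G) :
    gs.wedge a b * gs.Δ ^ n = gs.wedge (a * gs.Δ ^ n) (b * gs.Δ ^ n) := by
  refine gs.eq_of_forall_pre_iff fun t => ?_
  obtain ⟨t, rfl⟩ : ∃ s, t = s * gs.Δ ^ n := ⟨t * (gs.Δ ^ n)⁻¹, by simp⟩
  simp only [pre_mul_Delta_zpow, pre_wedge_iff]

lemma wedge_mul_Delta (a b : G) :
    gs.wedge a b * gs.Δ = gs.wedge (a * gs.Δ) (b * gs.Δ) := by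
  simpa using gs.wedge_mul_Delta_zpow 1 a b

lemma wedge_comm (a b : G) : gs.wedge a b = gs.wedge b a :=
  gs.eq_of_forall_pre_iff fun t => by simp only [pre_wedge_iff, and_comm]

lemma pre_inv_iff {a : G} {n : ℤ} : gs.pre a⁻¹ (gs.Δ ^ n) ↔ gs.pre (gs.Δ ^ (-n)) a := by
  rw [pre, pre, ← gs.conj_Delta_zpow_mem_iff n ((gs.Δ ^ (-n))⁻¹ * a)]
  simp

lemma exists_pre_Delta_pow (g : G) : ∃ n : ℕ, gs.pre g (gs.Δ ^ (n : ℤ)) ∧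
    gs.pre g⁻¹ (gs.Δ ^ (n : ℤ)) := by
  have hg : g ∈ Subgroup.closure {s : G | s ∈ gs.P ∧ s⁻¹ * gs.Δ ∈ gs.P} := by
    rw [gs.simples_generate]; trivial
  induction hg using Subgroup.closure_induction with
  | mem s hs =>
    refine ⟨1, by simpa [pre] using hs.2, ?_⟩
    simpa [pre] using gs.mul_mem hs.1 gs.Δ_mem
  | one => exact ⟨0, by simpa using gs.pre_refl 1, by simpa using gs.pre_refl 1⟩
  | mul a b _ _ ha hb =>
    obtain ⟨n, hn, hn'⟩ := ha
    obtain ⟨m, hm, hm'⟩ := hb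
    have key : ∀ {a b : G} {n m : ℕ}, gs.pre a (gs.Δ ^ (n : ℤ)) → gs.pre b (gs.Δ ^ (m : ℤ)) →
        gs.pre (a * b) (gs.Δ ^ ((n + m : ℕ) : ℤ)) := by
      intro a b n m hn hm
      have h1 := (gs.pre_mul_left a).2 hm
      have h2 := (gs.pre_mul_Delta_zpow m).2 hn
      rw [← zpow_add] at h2
      exact_mod_cast h1.trans h2
    refine ⟨n + m, key hn hm, ?_⟩
    rw [mul_inv_rev, add_comm]
    exact key hm' hn'
  | inv a _ ha =>
    obtain ⟨n, hn, hn'⟩ := ha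
    exact ⟨n, hn', by simpa using hn⟩

lemma eq_one_of_Delta_eq_one (h : gs.Δ = 1) (g : G) : g = 1 := by
  obtain ⟨n, h1, h2⟩ := gs.exists_pre_Delta_pow g
  rw [h, one_zpow] at h1 h2
  refine gs.eq_one_of_mem_of_inv_mem g ?_ ?_
  · simpa [pre] using h2
  · simpa [pre] using h1

lemma pre_one_of_wedge_Delta_eq_one {g : G} (h : gs.wedge g gs.Δ = 1) (n : ℕ) :
    ∀ t, gs.pre t g → gs.pre t (gs.Δ ^ (n : ℤ)) → gs.pre t 1 := by
  induction n with
  | zero => intro t _ h'; simpa using h'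
  | succ n ih =>
    intro t ht ht'
    have hle : gs.pre (gs.wedge g (gs.Δ ^ (n : ℤ))) 1 :=
      ih _ (gs.wedge_le_left _ _) (gs.wedge_le_right _ _)
    have hle' := (gs.pre_mul_Delta).2 hle
    rw [wedge_mul_Delta, one_mul, ← zpow_add_one] at hle'
    rw [← h, pre_wedge_iff]
    refine ⟨ht, pre.trans (gs.pre_wedge_iff.2 ⟨ht.trans (gs.pre_self_mul_Delta g), ?_⟩) hle'⟩
    exact_mod_cast ht'

lemma eq_one_of_wedge_Delta_eq_one {g : G} (hg : g ∈ gs.P) (h : gs.wedge g gs.Δ = 1) : g = 1 := by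
  obtain ⟨n, hn, -⟩ := gs.exists_pre_Delta_pow g
  exact (gs.pre_one_of_wedge_Delta_eq_one h n g (gs.pre_refl g) hn).antisymm (gs.one_pre.2 hg)

end Order

section Norm

variable (gs : GarsideStructure G)

lemma list_prod_mem {L : List G} (hL : ∀ a ∈ L, a ∈ gs.P ∧ a ≠ 1) : L.prod ∈ gs.P := by
  induction L with
  | nil => simpa using gs.one_mem
  | cons a L ih =>
    simp only [List.mem_cons, forall_eq_or_imp] at hL
    rw [List.prod_cons]
    exact gs.mul_mem hL.1.1 (ih hL.2)

lemma bddAbove_lengths {x : G} (hx : x ∈ gs.P) :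
    BddAbove {k : ℕ | ∃ L : List G, (∀ a ∈ L, a ∈ gs.P ∧ a ≠ 1) ∧ L.prod = x ∧ L.length = k} := by
  by_cases h1 : x = 1
  · refine ⟨0, ?_⟩
    rintro k ⟨L, hL, hp, rfl⟩
    cases L with
    | nil => simp
    | cons a L =>
      exfalso
      simp only [List.mem_cons, forall_eq_or_imp] at hL
      rw [List.prod_cons, h1] at hp
      refine hL.1.2 (gs.eq_one_of_mem_of_inv_mem a hL.1.1 ?_)
      rw [inv_eq_of_mul_eq_one_right hp]
      exact gs.list_prod_mem hL.2
  · obtain ⟨n, hn⟩ := gs.norm_bounded x hx h1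
    exact ⟨n, by rintro k ⟨L, hL, hp, rfl⟩; exact hn L hL hp⟩

lemma exists_list_length_eq_gnorm {x : G} (hx : x ∈ gs.P) :
    ∃ L : List G, (∀ a ∈ L, a ∈ gs.P ∧ a ≠ 1) ∧ L.prod = x ∧ L.length = gs.gnorm x := by
  refine Nat.sSup_mem (s := {k : ℕ | ∃ L : List G, (∀ a ∈ L, a ∈ gs.P ∧ a ≠ 1) ∧
    L.prod = x ∧ L.length = k}) ?_ (gs.bddAbove_lengths hx)
  by_cases h1 : x = 1
  · exact ⟨0, [], by simp, by simp [h1], rfl⟩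
  · exact ⟨1, [x], by simp [hx, h1], by simp, rfl⟩

lemma length_le_gnorm {L : List G} (hL : ∀ a ∈ L, a ∈ gs.P ∧ a ≠ 1) :
    L.length ≤ gs.gnorm L.prod :=
  le_csSup (gs.bddAbove_lengths (gs.list_prod_mem hL)) ⟨L, hL, rfl, rfl⟩

lemma gnorm_add_gnorm_le {a b : G} (ha : a ∈ gs.P) (hb : b ∈ gs.P) :
    gs.gnorm a + gs.gnorm b ≤ gs.gnorm (a * b) := by
  obtain ⟨L, hL, rfl, hL'⟩ := gs.exists_list_length_eq_gnorm ha
  obtain ⟨M, hM, rfl, hM'⟩ := gs.exists_list_length_eq_gnorm hb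
  rw [← hL', ← hM', ← List.length_append, ← List.prod_append]
  refine gs.length_le_gnorm fun a h => ?_
  rcases List.mem_append.1 h with h | h
  exacts [hL a h, hM a h]

lemma gnorm_pos {a : G} (ha : a ∈ gs.P) (h1 : a ≠ 1) : 0 < gs.gnorm a := by
  simpa [Nat.one_le_iff_ne_zero, Nat.pos_iff_ne_zero] using
    gs.length_le_gnorm (L := [a]) (by simp [ha, h1])

lemma gnorm_lt_of_pre {w a b : G} (hwa : gs.pre w a) (hab : gs.pre a b) (h : a ≠ b) :
    gs.gnorm (w⁻¹ * a) < gs.gnorm (w⁻¹ * b) := by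
  have h1 := gs.gnorm_add_gnorm_le hwa hab
  have h2 := gs.gnorm_pos hab (fun h' => h (eq_of_inv_mul_eq_one h'))
  simp only [mul_assoc, mul_inv_cancel_left] at h1
  omega

lemma gnorm_lt_of_pre_left {a b u : G} (hab : gs.pre a b) (hbu : gs.pre b u) (h : a ≠ b) :
    gs.gnorm (b⁻¹ * u) < gs.gnorm (a⁻¹ * u) := by
  have h1 := gs.gnorm_add_gnorm_le hab hbu
  have h2 := gs.gnorm_pos hab (fun h' => h (eq_of_inv_mul_eq_one h'))
  simp only [mul_assoc, mul_inv_cancel_left] at h1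
  omega

end Norm

section Cycling

variable (gs : GarsideStructure G)

/-- The conjugators `u` for which `Δ ^ r ⪯ u⁻¹ * x * u`. -/
def conjAbove (x : G) (r : ℤ) : Set G := {u | gs.pre (u * gs.Δ ^ r) (x * u)}

/-- The effect of cycling `u⁻¹ * x * u`, whose infimum is `r - 1`, on the conjugator `u`,
normalised by a factor `Δ⁻¹`. -/
def cycStep (x : G) (r : ℤ) (u : G) : G := gs.wedge (x * u * gs.Δ ^ (-r)) u

variable {gs} {x : G} {r : ℤ}

lemma mem_conjAbove {u : G} : u ∈ gs.conjAbove x r ↔ gs.pre (u * gs.Δ ^ r) (x * u) := Iff.rfl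

lemma mem_conjAbove_iff_pre {u : G} :
    u ∈ gs.conjAbove x r ↔ gs.pre u (x * u * gs.Δ ^ (-r)) := by
  rw [mem_conjAbove, ← gs.pre_mul_Delta_zpow (-r)]
  simp [mul_assoc]

lemma mul_Delta_zpow_mem_conjAbove {u : G} (hu : u ∈ gs.conjAbove x r) (n : ℤ) :
    u * gs.Δ ^ n ∈ gs.conjAbove x r := by
  have := (gs.pre_mul_Delta_zpow n).2 (mem_conjAbove.1 hu)
  rw [mem_conjAbove, mul_assoc, ← zpow_add, add_comm, zpow_add]
  simpa only [mul_assoc] using this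

lemma mul_Delta_mem_conjAbove {u : G} (hu : u ∈ gs.conjAbove x r) :
    u * gs.Δ ∈ gs.conjAbove x r := by
  simpa using mul_Delta_zpow_mem_conjAbove hu 1

lemma vee_mem_conjAbove {u v : G} (hu : u ∈ gs.conjAbove x r) (hv : v ∈ gs.conjAbove x r) :
    gs.vee u v ∈ gs.conjAbove x r := by
  rw [mem_conjAbove_iff_pre] at *
  refine gs.vee_le _ _ _ (hu.trans ?_) (hv.trans ?_) <;>
    refine (gs.pre_mul_Delta_zpow _).2 ((gs.pre_mul_left _).2 ?_)
  exacts [gs.le_vee_left u v, gs.le_vee_right u v]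

lemma cycStep_pre (u : G) : gs.pre (gs.cycStep x r u) u := gs.wedge_le_right _ _

lemma cycStep_eq_self_iff {u : G} : gs.cycStep x r u = u ↔ u ∈ gs.conjAbove x r := by
  rw [mem_conjAbove_iff_pre]
  refine ⟨fun h => ?_, fun h => (cycStep_pre u).antisymm (gs.pre_wedge_iff.2 ⟨h, gs.pre_refl u⟩)⟩
  have := gs.wedge_le_left (x * u * gs.Δ ^ (-r)) u
  rwa [← cycStep, h] at this

lemma cycStep_wedge (u v : G) :
    gs.cycStep x r (gs.wedge u v) = gs.wedge (gs.cycStep x r u) (gs.cycStep x r v) := by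
  refine gs.eq_of_forall_pre_iff fun t => ?_
  simp only [cycStep, mul_wedge, wedge_mul_Delta_zpow, pre_wedge_iff]
  tauto

lemma exists_isGreatest_conjAbove_pre (hne : (gs.conjAbove x r).Nonempty) (u : G) :
    ∃ w ∈ gs.conjAbove x r, gs.pre w u ∧ ∀ w' ∈ gs.conjAbove x r, gs.pre w' u → gs.pre w' w := by
  obtain ⟨w, hw⟩ := hne
  obtain ⟨n, -, hn⟩ := gs.exists_pre_Delta_pow (w⁻¹ * u)
  have hS : ∃ w ∈ gs.conjAbove x r, gs.pre w u := by
    refine ⟨_, mul_Delta_zpow_mem_conjAbove hw (-n), ?_⟩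
    simpa using (gs.pre_mul_left w).2 (gs.pre_inv_iff.1 hn)
  have hT : ∃ k, ∃ w ∈ gs.conjAbove x r, gs.pre w u ∧ gs.gnorm (w⁻¹ * u) = k := by
    obtain ⟨w, h1, h2⟩ := hS
    exact ⟨_, w, h1, h2, rfl⟩
  classical
  obtain ⟨w, hwC, hwu, hwk⟩ := Nat.find_spec hT
  refine ⟨w, hwC, hwu, fun w' hwC' hwu' => ?_⟩
  by_contra hcon
  have hvu : gs.pre (gs.vee w w') u := gs.vee_le _ _ _ hwu hwu'
  have hne : w ≠ gs.vee w w' := fun h => hcon (by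
    have := gs.le_vee_right w w'
    rwa [← h] at this)
  have hlt := gs.gnorm_lt_of_pre_left (gs.le_vee_left w w') hvu hne
  exact Nat.find_min hT (hwk ▸ hlt) ⟨_, vee_mem_conjAbove hwC hwC', hvu, rfl⟩

lemma iterate_cycStep_of_mem {u : G} (hu : u ∈ gs.conjAbove x r) (k : ℕ) :
    (gs.cycStep x r)^[k] u = u :=
  Function.iterate_fixed (cycStep_eq_self_iff.2 hu) k

lemma iterate_cycStep_wedge (u v : G) (k : ℕ) :
    (gs.cycStep x r)^[k] (gs.wedge u v) =
      gs.wedge ((gs.cycStep x r)^[k] u) ((gs.cycStep x r)^[k] v) := by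
  induction k generalizing u v with
  | zero => rfl
  | succ k ih => simp only [Function.iterate_succ_apply, cycStep_wedge, ih]

lemma iterate_cycStep_pre (u : G) (k : ℕ) : gs.pre ((gs.cycStep x r)^[k] u) u := by
  induction k with
  | zero => exact gs.pre_refl u
  | succ k ih =>
    rw [Function.iterate_succ_apply']
    exact (cycStep_pre _).trans ih

lemma pre_iterate_cycStep {w u : G} (hw : w ∈ gs.conjAbove x r) (hwu : gs.pre w u) (k : ℕ) :
    gs.pre w ((gs.cycStep x r)^[k] u) := by
  have h : gs.wedge w u = w :=
    pre.antisymm (gs.wedge_le_left w u) (gs.pre_wedge_iff.2 ⟨gs.pre_refl w, hwu⟩)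
  have h' := iterate_cycStep_wedge (gs := gs) (x := x) (r := r) w u k
  rw [h, iterate_cycStep_of_mem hw] at h'
  rw [h']
  exact gs.wedge_le_right _ _

/-- Iterated cycling reaches a prescribed infimum `r` in at most `‖Δ‖ - 1` steps, as soon as some
conjugate of `x` has infimum at least `r`. -/
theorem iterate_cycStep_mem_conjAbove (hΔ : gs.Δ ≠ 1) (hne : (gs.conjAbove x r).Nonempty) (u : G) :
    (gs.cycStep x r)^[gs.gnorm gs.Δ - 1] u ∈ gs.conjAbove x r := by
  obtain ⟨w, hw, hwu, hmax⟩ := exists_isGreatest_conjAbove_pre hne u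
  set v := gs.wedge u (w * gs.Δ) with hv
  have hwv : gs.pre w v := gs.pre_wedge_iff.2 ⟨hwu, gs.pre_self_mul_Delta w⟩
  have hvu : gs.pre v u := gs.wedge_le_left _ _
  have hvΔ : v ≠ w * gs.Δ := by
    intro h
    have h' := hmax _ (mul_Delta_mem_conjAbove hw) (h ▸ hvu)
    exact hΔ (by simpa using (h'.antisymm (gs.pre_self_mul_Delta w)))
  have hnorm := gs.gnorm_lt_of_pre hwv (gs.wedge_le_right u (w * gs.Δ)) hvΔ
  rw [inv_mul_cancel_left] at hnorm
  have key : ∀ k, (gs.cycStep x r)^[k] v = w ∨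
      gs.gnorm (w⁻¹ * (gs.cycStep x r)^[k] v) + k ≤ gs.gnorm (w⁻¹ * v) := by
    intro k
    induction k with
    | zero => right; simp
    | succ k ih =>
      rw [Function.iterate_succ_apply']
      rcases ih with ih | ih
      · left
        rw [ih, cycStep_eq_self_iff.2 hw]
      · by_cases hfix : gs.cycStep x r ((gs.cycStep x r)^[k] v) = (gs.cycStep x r)^[k] v
        · left
          rw [hfix]
          refine pre.antisymm (hmax _ (cycStep_eq_self_iff.1 hfix) ?_) (pre_iterate_cycStep hw hwv k)
          exact (iterate_cycStep_pre v k).trans hvu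
        · right
          have h1 := pre_iterate_cycStep (k := k + 1) hw hwv
          rw [Function.iterate_succ_apply'] at h1
          have := gs.gnorm_lt_of_pre h1 (cycStep_pre _) hfix
          omega
  have hvw : (gs.cycStep x r)^[gs.gnorm gs.Δ - 1] v = w := by
    rcases key (gs.gnorm gs.Δ - 1) with h | h
    · exact h
    · by_contra hcon
      have := gs.gnorm_pos (pre_iterate_cycStep hw hwv (gs.gnorm gs.Δ - 1))
        (fun h' => hcon (eq_of_inv_mul_eq_one h').symm)
      omega
  rw [hv, iterate_cycStep_wedge, iterate_cycStep_of_mem (mul_Delta_mem_conjAbove hw)] at hvw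
  have h1 : w⁻¹ * (gs.cycStep x r)^[gs.gnorm gs.Δ - 1] u = 1 := by
    refine gs.eq_one_of_wedge_Delta_eq_one (pre_iterate_cycStep hw hwu _) ?_
    have := congrArg (w⁻¹ * ·) hvw
    simpa [mul_wedge] using this
  rwa [← eq_of_inv_mul_eq_one h1]

end Cycling

section Summit

variable {gs : GarsideStructure G}

lemma le_of_Delta_zpow_pre (hΔ : gs.Δ ≠ 1) {m n : ℤ} (h : gs.pre (gs.Δ ^ m) (gs.Δ ^ n)) :
    m ≤ n := by
  by_contra hlt
  have h1 : gs.pre (gs.Δ ^ (n + 1)) (gs.Δ ^ n) := by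
    have := gs.pre_mul_zpow_of_le 1 (show n + 1 ≤ m by omega)
    rw [one_mul, one_mul] at this
    exact this.trans h
  have h2 : gs.pre (gs.Δ ^ n) (gs.Δ ^ (n + 1)) := by
    rw [zpow_add_one]
    exact gs.pre_self_mul_Delta _
  have := h1.antisymm h2
  rw [zpow_add_one, mul_eq_left] at this
  exact hΔ this

lemma le_ginf_iff (hΔ : gs.Δ ≠ 1) {x : G} {p : ℤ} : p ≤ gs.ginf x ↔ gs.pre (gs.Δ ^ p) x := by
  obtain ⟨n, h1, h2⟩ := gs.exists_pre_Delta_pow x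
  have hmem : gs.pre (gs.Δ ^ gs.ginf x) x :=
    Int.csSup_mem (s := {p : ℤ | gs.pre (gs.Δ ^ p) x}) ⟨-n, gs.pre_inv_iff.1 h2⟩
      ⟨n, fun p hp => le_of_Delta_zpow_pre hΔ (pre.trans hp h1)⟩
  refine ⟨fun h => ?_, fun h => le_csSup ⟨n, fun p hp => le_of_Delta_zpow_pre hΔ (pre.trans hp h1)⟩ h⟩
  have := gs.pre_mul_zpow_of_le 1 h
  rw [one_mul, one_mul] at this
  exact this.trans hmem

lemma gsup_le_iff (hΔ : gs.Δ ≠ 1) {x : G} {q : ℤ} : gs.gsup x ≤ q ↔ gs.pre x (gs.Δ ^ q) := by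
  obtain ⟨n, h1, h2⟩ := gs.exists_pre_Delta_pow x
  have hbdd : BddBelow {q : ℤ | gs.pre x (gs.Δ ^ q)} :=
    ⟨-n, fun p hp => le_of_Delta_zpow_pre hΔ (pre.trans (gs.pre_inv_iff.1 h2) hp)⟩
  have hmem : gs.pre x (gs.Δ ^ gs.gsup x) :=
    Int.csInf_mem (s := {q : ℤ | gs.pre x (gs.Δ ^ q)}) ⟨n, h1⟩ hbdd
  refine ⟨fun h => ?_, fun h => csInf_le hbdd h⟩
  have := gs.pre_mul_zpow_of_le 1 h
  rw [one_mul, one_mul] at this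
  exact hmem.trans this

lemma le_ginf_conj_iff (hΔ : gs.Δ ≠ 1) {x u : G} {p : ℤ} :
    p ≤ gs.ginf (u⁻¹ * x * u) ↔ u ∈ gs.conjAbove x p := by
  rw [le_ginf_iff hΔ, mem_conjAbove, ← gs.pre_mul_left u]
  simp [mul_assoc]

lemma gsup_inv (hΔ : gs.Δ ≠ 1) (x : G) : gs.gsup x⁻¹ = -gs.ginf x := by
  refine eq_of_forall_ge_iff fun q => ?_
  rw [gsup_le_iff hΔ, pre_inv_iff, ← le_ginf_iff hΔ, neg_le]

lemma ginf_inv (hΔ : gs.Δ ≠ 1) (x : G) : gs.ginf x⁻¹ = -gs.gsup x := by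
  have := gsup_inv hΔ x⁻¹
  rw [inv_inv] at this
  omega

lemma glen_inv (hΔ : gs.Δ ≠ 1) (x : G) : gs.glen x⁻¹ = gs.glen x := by
  simp only [glen, ginf_inv hΔ, gsup_inv hΔ]
  ring

lemma pp_inv (hΔ : gs.Δ ≠ 1) (x : G) : gs.pp x⁻¹ = gs.pp x := by
  simp only [pp, ginf_inv hΔ, gsup_inv hΔ, neg_neg, inv_inv]
  rw [gs.wedge_comm (x⁻¹ * _)]

lemma sl_inv (hΔ : gs.Δ ≠ 1) (x : G) : gs.sl x⁻¹ = (gs.sl x)⁻¹ := by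
  simp [sl, pp_inv hΔ, mul_assoc]

lemma iterate_sl_inv (hΔ : gs.Δ ≠ 1) (x : G) (m : ℕ) :
    (gs.sl)^[m] x⁻¹ = ((gs.sl)^[m] x)⁻¹ :=
  ((Function.Semiconj.iterate_right (f := fun y : G => y⁻¹) (ga := gs.sl) (gb := gs.sl)
    (fun y => (sl_inv hΔ y).symm)) m x).symm

lemma ginf_le_ginf_sl (hΔ : gs.Δ ≠ 1) (x : G) : gs.ginf x ≤ gs.ginf (gs.sl x) := by
  rw [sl, le_ginf_conj_iff hΔ, mem_conjAbove_iff_pre]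
  have hx : gs.pre 1 (x * gs.Δ ^ (-gs.ginf x)) := by
    have := (le_ginf_iff hΔ).1 (le_refl (gs.ginf x))
    rw [← gs.pre_mul_Delta_zpow (-gs.ginf x)] at this
    simpa using this
  have h1 : gs.pre (gs.pp x) (x * gs.Δ ^ (-gs.ginf x)) :=
    pre.trans (gs.wedge_le_left _ _) (gs.wedge_le_left _ _)
  have hp : gs.pre 1 (gs.pp x) := by
    have hq := (gsup_le_iff hΔ).1 (le_refl (gs.gsup x))
    rw [← gs.pre_mul_left x⁻¹] at hq
    exact gs.pre_wedge_iff.2 ⟨gs.pre_wedge_iff.2 ⟨hx, by simpa using hq⟩, gs.one_pre.2 gs.Δ_mem⟩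
  refine h1.trans ((gs.pre_mul_Delta_zpow _).2 ?_)
  simpa using (gs.pre_mul_left x).2 hp

lemma gsup_sl_le_gsup (hΔ : gs.Δ ≠ 1) (x : G) : gs.gsup (gs.sl x) ≤ gs.gsup x := by
  have := ginf_le_ginf_sl hΔ x⁻¹
  rw [sl_inv hΔ, ginf_inv hΔ, ginf_inv hΔ] at this
  omega

lemma ginf_le_ginf_iterate_sl (hΔ : gs.Δ ≠ 1) (x : G) (m : ℕ) :
    gs.ginf x ≤ gs.ginf ((gs.sl)^[m] x) := by
  induction m with
  | zero => rfl
  | succ m ih =>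
    rw [Function.iterate_succ_apply']
    exact ih.trans (ginf_le_ginf_sl hΔ _)

lemma gsup_iterate_sl_le_gsup (hΔ : gs.Δ ≠ 1) (x : G) (m : ℕ) :
    gs.gsup ((gs.sl)^[m] x) ≤ gs.gsup x := by
  induction m with
  | zero => rfl
  | succ m ih =>
    rw [Function.iterate_succ_apply']
    exact (gsup_sl_le_gsup hΔ _).trans ih

lemma glen_iterate_sl_le (hΔ : gs.Δ ≠ 1) (x : G) (m : ℕ) :
    gs.glen ((gs.sl)^[m] x) ≤ gs.glen x :=
  sub_le_sub (gsup_iterate_sl_le_gsup hΔ x m) (ginf_le_ginf_iterate_sl hΔ x m)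

variable (gs)

/-- The effect of cycling `u⁻¹ * x⁻¹ * u`, where `u⁻¹ * x * u` has supremum `q`, on the
conjugator `u`. -/
def cycInvStep (x : G) (q : ℤ) (u : G) : G := gs.wedge (x⁻¹ * u * gs.Δ ^ q) (u * gs.Δ)

variable {gs}

lemma commute_cycStep_cycInvStep (x : G) (p q : ℤ) :
    Function.Commute (gs.cycStep x (p + 1)) (gs.cycInvStep x q) := by
  intro u
  refine gs.eq_of_forall_pre_iff fun t => ?_
  have e1 : gs.Δ ^ q * gs.Δ ^ (-(p + 1)) = gs.Δ ^ (-(p + 1)) * gs.Δ ^ q := by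
    rw [← zpow_add, ← zpow_add, add_comm]
  have e2 : gs.Δ * gs.Δ ^ (-(p + 1)) = gs.Δ ^ (-(p + 1)) * gs.Δ := by
    rw [← zpow_one_add, ← zpow_add_one, add_comm]
  simp only [cycStep, cycInvStep, mul_wedge, wedge_mul_Delta_zpow, wedge_mul_Delta, pre_wedge_iff,
    mul_assoc, e1, e2, mul_inv_cancel_left, inv_mul_cancel_left]
  tauto

lemma mul_pp_conj {x u : G} {p q : ℤ} (hpq : p + 2 ≤ q) (hp : gs.ginf (u⁻¹ * x * u) = p)
    (hq : gs.gsup (u⁻¹ * x * u) = q) :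
    u * gs.pp (u⁻¹ * x * u) = gs.cycStep x (p + 1) (gs.cycInvStep x q u) := by
  refine gs.eq_of_forall_pre_iff fun t => ?_
  have e1 : gs.Δ ^ q * gs.Δ ^ (-(p + 1)) = gs.Δ ^ (q - p - 1) := by
    rw [← zpow_add]; congr 1; ring
  have e2 : gs.Δ * gs.Δ ^ (-(p + 1)) = gs.Δ ^ (-p) := by
    rw [← zpow_one_add]; congr 1; ring
  have e3 : gs.pre t (u * gs.Δ) → gs.pre t (u * gs.Δ ^ (q - p - 1)) := fun h =>
    h.trans (by simpa using gs.pre_mul_zpow_of_le u (show 1 ≤ q - p - 1 by omega))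
  rw [pp, hp, hq]
  simp only [cycStep, cycInvStep, mul_wedge, wedge_mul_Delta_zpow, pre_wedge_iff,
    mul_assoc, e1, e2, mul_inv_cancel_left, mul_inv_rev, inv_inv]
  tauto

lemma iterate_sl_eq_conj {x : G} {p q : ℤ} (hpq : p + 2 ≤ q) {N : ℕ}
    (h : ∀ m ≤ N, gs.ginf ((gs.sl)^[m] x) = p ∧ gs.gsup ((gs.sl)^[m] x) = q) :
    ∀ m ≤ N, (gs.sl)^[m] x = ((gs.cycStep x (p + 1) ∘ gs.cycInvStep x q)^[m] 1)⁻¹ * x *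
      (gs.cycStep x (p + 1) ∘ gs.cycInvStep x q)^[m] 1 := by
  intro m hm
  induction m with
  | zero => simp
  | succ m ih =>
    have ih := ih (by omega)
    obtain ⟨hp, hq⟩ := h m (by omega)
    rw [Function.iterate_succ_apply', Function.iterate_succ_apply', Function.comp_apply, ih]
    rw [ih] at hp hq
    rw [← mul_pp_conj hpq hp hq, sl]
    simp only [mul_inv_rev, mul_assoc]

lemma iterate_cycStep_one {x : G} {p : ℤ} (hx : gs.pre x (gs.Δ ^ (p + 1))) (k : ℕ) :
    (gs.cycStep x (p + 1))^[k] 1 = x ^ k * gs.Δ ^ (-(p + 1) * k) := by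
  induction k with
  | zero => simp
  | succ k ih =>
    rw [Function.iterate_succ_apply', ih, cycStep]
    have hle : gs.pre (x * (x ^ k * gs.Δ ^ (-(p + 1) * k)) * gs.Δ ^ (-(p + 1)))
        (x ^ k * gs.Δ ^ (-(p + 1) * k)) := by
      rw [← mul_assoc, ← pow_succ', pow_succ, mul_assoc, mul_assoc, gs.pre_mul_left, ← zpow_add]
      have := (gs.pre_mul_Delta_zpow (-(p + 1) * k + -(p + 1))).2 hx
      rw [← zpow_add] at this
      convert this using 2
      ring
    refine (pre.antisymm (gs.wedge_le_left _ _) (gs.pre_wedge_iff.2 ⟨gs.pre_refl _, hle⟩)).trans ?_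
    rw [pow_succ', mul_assoc, mul_assoc, mul_assoc, ← zpow_add]
    congr 3
    push_cast
    ring

/-- An element whose infimum is not maximal in its conjugacy class has canonical length at
least two. -/
lemma ginf_add_two_le_gsup (hΔ : gs.Δ ≠ 1) {x : G}
    (hne : (gs.conjAbove x (gs.ginf x + 1)).Nonempty) : gs.ginf x + 2 ≤ gs.gsup x := by
  by_contra hlt
  have hx := (gsup_le_iff hΔ (x := x) (q := gs.ginf x + 1)).1 (by omega)
  have hmem := iterate_cycStep_mem_conjAbove hΔ hne 1
  rw [iterate_cycStep_one hx] at hmem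
  have hmem := mul_Delta_zpow_mem_conjAbove hmem (-(-(gs.ginf x + 1) * (gs.gnorm gs.Δ - 1 : ℕ)))
  rw [mul_assoc, ← zpow_add, add_neg_cancel, zpow_zero, mul_one, mem_conjAbove, ← pow_succ',
    pow_succ, gs.pre_mul_left, ← le_ginf_iff hΔ] at hmem
  omega

theorem exists_glen_iterate_sl_lt_of_ginf_lt (hΔ : gs.Δ ≠ 1) {x α : G}
    (hα : gs.ginf x < gs.ginf (α⁻¹ * x * α)) :
    ∃ m : ℕ, 0 < m ∧ m < gs.gnorm gs.Δ ∧ gs.glen ((gs.sl)^[m] x) < gs.glen x := by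
  by_contra! hcon
  have hne : (gs.conjAbove x (gs.ginf x + 1)).Nonempty := ⟨α, (le_ginf_conj_iff hΔ).1 hα⟩
  have hpq := ginf_add_two_le_gsup hΔ hne
  have hpos := gs.gnorm_pos gs.Δ_mem hΔ
  have hconst : ∀ m ≤ gs.gnorm gs.Δ - 1,
      gs.ginf ((gs.sl)^[m] x) = gs.ginf x ∧ gs.gsup ((gs.sl)^[m] x) = gs.gsup x := by
    intro m hm
    rcases Nat.eq_zero_or_pos m with rfl | h0
    · exact ⟨rfl, rfl⟩
    · have h1 := hcon m h0 (by omega)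
      have h2 := ginf_le_ginf_iterate_sl hΔ x m
      have h3 := gsup_iterate_sl_le_gsup hΔ x m
      simp only [glen] at h1
      constructor <;> omega
  have hsl := iterate_sl_eq_conj hpq hconst _ le_rfl
  rw [(commute_cycStep_cycInvStep x _ _).comp_iterate, Function.comp_apply] at hsl
  have h := (le_ginf_conj_iff hΔ).2 (iterate_cycStep_mem_conjAbove hΔ hne
    ((gs.cycInvStep x (gs.gsup x))^[gs.gnorm gs.Δ - 1] 1))
  rw [← hsl, (hconst _ le_rfl).1] at h
  omega

theorem exists_glen_iterate_sl_lt_of_gsup_lt (hΔ : gs.Δ ≠ 1) {x α : G}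
    (hα : gs.gsup (α⁻¹ * x * α) < gs.gsup x) :
    ∃ m : ℕ, 0 < m ∧ m < gs.gnorm gs.Δ ∧ gs.glen ((gs.sl)^[m] x) < gs.glen x := by
  have h : gs.ginf x⁻¹ < gs.ginf (α⁻¹ * x⁻¹ * α) := by
    rw [show α⁻¹ * x⁻¹ * α = (α⁻¹ * x * α)⁻¹ by simp [mul_assoc], ginf_inv hΔ, ginf_inv hΔ]
    omega
  obtain ⟨m, h0, hm, hlt⟩ := exists_glen_iterate_sl_lt_of_ginf_lt hΔ h
  rw [iterate_sl_inv hΔ, glen_inv hΔ, glen_inv hΔ] at hlt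
  exact ⟨m, h0, hm, hlt⟩

lemma not_glen_iterate_sl_lt (hΔ : gs.Δ ≠ 1) {y : G} {n : ℕ} (hn : 1 ≤ n)
    (hy : (gs.sl)^[n] y = y) (m : ℕ) : ¬ gs.glen ((gs.sl)^[m] y) < gs.glen y := by
  have h1 : (gs.sl)^[n * m] y = y := by
    rw [Function.iterate_mul]
    exact Function.iterate_fixed hy m
  have h2 := glen_iterate_sl_le hΔ ((gs.sl)^[m] y) (n * m - m)
  rw [← Function.iterate_add_apply, Nat.sub_add_cancel (Nat.le_mul_of_pos_left m hn), h1] at h2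
  exact not_lt.2 h2

end Summit

end GarsideStructure

/-- If the canonical length of `x` is not minimal in the conjugacy class of `x`, then it
strictly decreases after at most `‖Δ‖ - 1` cyclic slidings.  In particular,
`SC(x) ⊆ SSS(x)`. -/
theorem cyclic_sliding_reaches_SSS (gs : GarsideStructure G) (x : G) :
    ((¬ ∀ y : G, (∃ α : G, α⁻¹ * x * α = y) → gs.glen x ≤ gs.glen y) →
      ∃ m : ℕ, 0 < m ∧ m < gs.gnorm gs.Δ ∧ gs.glen ((gs.sl)^[m] x) < gs.glen x) ∧
    gs.SC x ⊆ gs.SSS x := by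
  by_cases hΔ : gs.Δ = 1
  · have hsub : ∀ a b : G, a = b := fun a b => by
      rw [gs.eq_one_of_Delta_eq_one hΔ a, gs.eq_one_of_Delta_eq_one hΔ b]
    refine ⟨fun h => absurd (fun y _ => (congrArg gs.glen (hsub x y)).le) h, fun y hy => ⟨hy.1, ?_⟩⟩
    intro z _
    rw [hsub z y]
    exact ⟨le_rfl, le_rfl⟩
  · constructor
    · intro h
      push Not at h
      obtain ⟨y, ⟨α, rfl⟩, hlt⟩ := h
      by_cases hinf : gs.ginf x < gs.ginf (α⁻¹ * x * α)
      · exact exists_glen_iterate_sl_lt_of_ginf_lt hΔ hinf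
      · refine exists_glen_iterate_sl_lt_of_gsup_lt hΔ (α := α) ?_
        simp only [glen] at hlt
        omega
    · rintro y ⟨⟨α, rfl⟩, n, hn, hy⟩
      refine ⟨⟨α, rfl⟩, ?_⟩
      rintro z ⟨γ, rfl⟩
      have hz : γ⁻¹ * x * γ = (α⁻¹ * γ)⁻¹ * (α⁻¹ * x * α) * (α⁻¹ * γ) := by
        simp only [mul_inv_rev, inv_inv, mul_assoc, mul_inv_cancel_left]
      rw [hz]
      constructor
      · by_contra! hlt
        obtain ⟨m, -, -, hm⟩ := exists_glen_iterate_sl_lt_of_ginf_lt hΔ hlt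
        exact not_glen_iterate_sl_lt hΔ hn hy m hm
      · by_contra! hlt
        obtain ⟨m, -, -, hm⟩ := exists_glen_iterate_sl_lt_of_gsup_lt hΔ hlt
        exact not_glen_iterate_sl_lt hΔ hn hy m hm
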